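/- Let X be a distributive lattice and fix a, y, b ∈ X. Define the binary product x • z := L(x,a,y,b,z). Then • is associative: (x • w) • z = x • (w • z) for all x, w, z ∈ X; moreover • is a weak band: (v • v) • w = v • w and v • (w • w) = v • w for all v, w ∈ X. -/

import Mathlib

/-- The quintary map `L` of a lattice. -/
def latticeL {X : Type*} [Lattice X] (x a y b z : X) : X :=
  (b ⊓ (z ⊔ (a ⊓ y))) ⊔ (z ⊓ (b ⊔ (x ⊓ y))) ⊔ (x ⊓ (a ⊔ (z ⊓ y))) ⊔ (a ⊓ (x ⊔ (b ⊓ y)))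

namespace DistribLattice

open Order

theorem eq_of_forall_isPrime_mem_iff {X : Type*} [DistribLattice X] {p q : X}
    (h : ∀ I : Ideal X, I.IsPrime → (p ∈ I ↔ q ∈ I)) : p = q := by
  have le_of_mem {r s : X} (hrs : ∀ I : Ideal X, I.IsPrime → s ∈ I → r ∈ I) : r ≤ s := by
    by_contra hle
    have hdisj : Disjoint (PFilter.principal r : Set X) (Ideal.principal s : Set X) := by
      refine Set.disjoint_left.mpr fun t hrt hts => hle ?_
      exact (PFilter.mem_principal.mp hrt).trans (Ideal.mem_principal.mp hts)
    obtain ⟨I, hI, hsI, hdI⟩ := prime_ideal_of_disjoint_filter_ideal hdisj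
    exact Set.disjoint_left.mp hdI (PFilter.mem_principal.mpr le_rfl)
      (hrs I hI (hsI (Ideal.mem_principal.mpr le_rfl)))
  exact le_antisymm (le_of_mem fun I hI => (h I hI).mpr) (le_of_mem fun I hI => (h I hI).mp)

end DistribLattice

theorem Order.Ideal.IsPrime.inf_mem_iff {X : Type*} [Lattice X] {I : Order.Ideal X}
    (hI : I.IsPrime) {p q : X} : p ⊓ q ∈ I ↔ p ∈ I ∨ q ∈ I :=
  ⟨hI.mem_or_mem, fun h => h.elim (I.lower inf_le_left) (I.lower inf_le_right)⟩

theorem Order.Ideal.IsPrime.latticeL_mem_iff {X : Type*} [Lattice X] {I : Order.Ideal X}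
    (hI : I.IsPrime) {x a y b z : X} :
    latticeL x a y b z ∈ I ↔
      (b ∈ I ∨ z ∈ I) ∧ (a ∈ I ∨ x ∈ I) ∧ (a ∈ I ∨ b ∈ I ∨ y ∈ I) ∧
        (x ∈ I ∨ y ∈ I ∨ z ∈ I) := by
  simp only [latticeL, Order.Ideal.sup_mem_iff, hI.inf_mem_iff]
  tauto

/-- In a distributive lattice, the principal product `x • z := L(x,a,y,b,z)` is
associative and a weak band. -/
theorem principal_product_assoc_weak_band {X : Type*} [DistribLattice X] (a y b : X) :
    (∀ x w z : X,
      latticeL (latticeL x a y b w) a y b z = latticeL x a y b (latticeL w a y b z)) ∧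
    (∀ v w : X,
      latticeL (latticeL v a y b v) a y b w = latticeL v a y b w ∧
      latticeL v a y b (latticeL w a y b w) = latticeL v a y b w) := by
  refine ⟨fun x w z => ?_, fun v w => ⟨?_, ?_⟩⟩ <;>
    refine DistribLattice.eq_of_forall_isPrime_mem_iff fun I hI => ?_ <;>
    simp only [hI.latticeL_mem_iff] <;>
    by_cases ha : a ∈ I <;> by_cases hb : b ∈ I <;> by_cases hy : y ∈ I <;>
    simp only [ha, hb, hy, true_or, or_true, false_or, or_false, true_and, and_true] <;>
    tauto
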